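/- Let q₁(x) ∈ ℂ[x] and q₂(y) ∈ ℂ[y] be nonzero polynomials with homogenizations 𝐪₁(X,Z) and 𝐪₂(Y,Z) in the homogenized Weyl algebra 𝐀(w). Then there exists an integer m ≥ 0 such that 𝐀(w)_{≥m} ⊆ 𝐪₁𝐀(w) + 𝐪₂𝐀(w), i.e. every homogeneous element of degree at least m lies in the right ideal generated by 𝐪₁ and 𝐪₂. -/

import Mathlib

noncomputable section

/-- Defining relations of the homogenized Weyl algebra of weight `w = (w₁, w₂)`:
`XZ = ZX`, `YZ = ZY`, `XY - YX = Z^(w₁+w₂)`. -/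
inductive HRel (w₁ w₂ : ℕ) : FreeAlgebra ℂ (Fin 3) → FreeAlgebra ℂ (Fin 3) → Prop
  | xz : HRel w₁ w₂ (FreeAlgebra.ι ℂ 0 * FreeAlgebra.ι ℂ 2) (FreeAlgebra.ι ℂ 2 * FreeAlgebra.ι ℂ 0)
  | yz : HRel w₁ w₂ (FreeAlgebra.ι ℂ 1 * FreeAlgebra.ι ℂ 2) (FreeAlgebra.ι ℂ 2 * FreeAlgebra.ι ℂ 1)
  | xy : HRel w₁ w₂ (FreeAlgebra.ι ℂ 0 * FreeAlgebra.ι ℂ 1 - FreeAlgebra.ι ℂ 1 * FreeAlgebra.ι ℂ 0)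
      (FreeAlgebra.ι ℂ 2 ^ (w₁ + w₂))

/-- The homogenized Weyl algebra `𝐀(w)` of weight `w = (w₁, w₂)`. -/
abbrev HWeyl (w₁ w₂ : ℕ) : Type := RingQuot (HRel w₁ w₂)

/-- The degree-`w₁` generator `X` of `𝐀(w)`. -/
def HX (w₁ w₂ : ℕ) : HWeyl w₁ w₂ := RingQuot.mkAlgHom ℂ (HRel w₁ w₂) (FreeAlgebra.ι ℂ 0)

/-- The degree-`w₂` generator `Y` of `𝐀(w)`. -/
def HY (w₁ w₂ : ℕ) : HWeyl w₁ w₂ := RingQuot.mkAlgHom ℂ (HRel w₁ w₂) (FreeAlgebra.ι ℂ 1)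

/-- The degree-`1` generator `Z` of `𝐀(w)`. -/
def HZ (w₁ w₂ : ℕ) : HWeyl w₁ w₂ := RingQuot.mkAlgHom ℂ (HRel w₁ w₂) (FreeAlgebra.ι ℂ 2)

/-- The degree-`k` graded component of `𝐀(w)`: the span of the monomials `X^a Y^b Z^c`
with `w₁ a + w₂ b + c = k`. -/
def HComp (w₁ w₂ : ℕ) (k : ℕ) : Submodule ℂ (HWeyl w₁ w₂) :=
  Submodule.span ℂ {m : HWeyl w₁ w₂ | ∃ a b c : ℕ, w₁ * a + w₂ * b + c = k ∧
    m = HX w₁ w₂ ^ a * HY w₁ w₂ ^ b * HZ w₁ w₂ ^ c}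

/-- The homogenization `𝐪₁(X,Z) = Σ aᵢ X^i Z^{w₁(d - i)}` in `𝐀(w)` of `q₁(x) = Σ aᵢ x^i`. -/
def homogX (w₁ w₂ : ℕ) (q : Polynomial ℂ) : HWeyl w₁ w₂ :=
  ∑ i ∈ Finset.range (q.natDegree + 1),
    q.coeff i • (HX w₁ w₂ ^ i * HZ w₁ w₂ ^ (w₁ * (q.natDegree - i)))

/-- The homogenization `𝐪₂(Y,Z) = Σ bᵢ Y^i Z^{w₂(d - i)}` in `𝐀(w)` of `q₂(y) = Σ bᵢ y^i`. -/
def homogY (w₁ w₂ : ℕ) (q : Polynomial ℂ) : HWeyl w₁ w₂ :=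
  ∑ i ∈ Finset.range (q.natDegree + 1),
    q.coeff i • (HY w₁ w₂ ^ i * HZ w₁ w₂ ^ (w₂ * (q.natDegree - i)))

/-- The homogenization `Σ qᵢ u^i z^{w(d - i)}` of a polynomial `q` of degree `d`, evaluated at
elements `u`, `z` of an algebra. -/
def homogAt {R : Type*} [Ring R] [Algebra ℂ R] (u z : R) (w : ℕ) (q : Polynomial ℂ) : R :=
  ∑ i ∈ Finset.range (q.natDegree + 1), q.coeff i • (u ^ i * z ^ (w * (q.natDegree - i)))

/-- The right ideal `p R + q R`, as a subspace. -/
def rightIdealPair {R : Type*} [Ring R] [Algebra ℂ R] (p q : R) : Submodule ℂ R :=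
  LinearMap.range (LinearMap.mulLeft ℂ p) ⊔ LinearMap.range (LinearMap.mulLeft ℂ q)

section Algebra

variable {R : Type*} [Ring R] [Algebra ℂ R]

lemma mem_rightIdealPair {p q m : R} :
    m ∈ rightIdealPair p q ↔ ∃ a b, m = p * a + q * b := by
  simp only [rightIdealPair, Submodule.mem_sup, LinearMap.mem_range, LinearMap.mulLeft_apply]
  constructor
  · rintro ⟨_, ⟨a, rfl⟩, _, ⟨b, rfl⟩, rfl⟩
    exact ⟨a, b, rfl⟩
  · rintro ⟨a, b, rfl⟩
    exact ⟨_, ⟨a, rfl⟩, _, ⟨b, rfl⟩, rfl⟩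

lemma mul_mem_rightIdealPair {p q m : R} (hm : m ∈ rightIdealPair p q) (v : R) :
    m * v ∈ rightIdealPair p q := by
  rw [mem_rightIdealPair] at *
  obtain ⟨a, b, rfl⟩ := hm
  exact ⟨a * v, b * v, by noncomm_ring⟩

lemma left_mul_mem_rightIdealPair (p q v : R) : p * v ∈ rightIdealPair p q :=
  mem_rightIdealPair.2 ⟨v, 0, by simp⟩

lemma right_mul_mem_rightIdealPair (p q v : R) : q * v ∈ rightIdealPair p q :=
  mem_rightIdealPair.2 ⟨0, v, by simp⟩

lemma commute_homogAt {u z : R} (h : Commute u z) (w : ℕ) (q : Polynomial ℂ) :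
    Commute u (homogAt u z w q) :=
  Commute.sum_right _ _ _ fun _ _ =>
    (((Commute.refl u).pow_right _).mul_right (h.pow_right _)).smul_right _

lemma pow_natDegree_eq_homogAt_add (u z : R) (w : ℕ) {q : Polynomial ℂ} (hq : q ≠ 0) :
    ∃ (γ : ℂ) (c : ℕ → ℂ), u ^ q.natDegree = γ • homogAt u z w q +
      ∑ i ∈ Finset.range q.natDegree, c i • (u ^ i * z ^ (w * (q.natDegree - i))) := by
  have hl : q.coeff q.natDegree ≠ 0 := by simpa using hq
  refine ⟨(q.coeff q.natDegree)⁻¹, fun i => -((q.coeff q.natDegree)⁻¹ * q.coeff i), ?_⟩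
  rw [homogAt, Finset.sum_range_succ, smul_add, smul_smul, inv_mul_cancel₀ hl]
  simp [Finset.smul_sum, neg_smul, smul_smul]

lemma pow_natDegree_mul_eq {u z : R} (h : Commute u z) {w : ℕ} (hw : 0 < w)
    (hz : ∀ v : R, Commute z v) {q : Polynomial ℂ} (hq : q ≠ 0) (k : ℕ) :
    ∃ a b, u ^ (q.natDegree * k) = homogAt u z w q * a + z ^ k * b := by
  obtain ⟨γ, c, hc⟩ := pow_natDegree_eq_homogAt_add u z w hq
  have hβ : ∃ β, u ^ q.natDegree = homogAt u z w q * algebraMap ℂ R γ + z * β := by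
    refine ⟨∑ i ∈ Finset.range q.natDegree, c i • (u ^ i * z ^ (w * (q.natDegree - i) - 1)), ?_⟩
    rw [hc, Finset.mul_sum, ← Algebra.commutes, ← Algebra.smul_def]
    congr 1
    refine Finset.sum_congr rfl fun i hi => ?_
    have hi : 0 < w * (q.natDegree - i) := Nat.mul_pos hw (by simp at hi; omega)
    rw [mul_smul_comm, ← mul_assoc, (hz (u ^ i)).eq, mul_assoc, ← pow_succ', Nat.sub_add_cancel hi]
  obtain ⟨β, hβ⟩ := hβ
  induction k with
  | zero => exact ⟨0, 1, by simp⟩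
  | succ k ih =>
    obtain ⟨a, b, hab⟩ := ih
    have hcomm := ((commute_homogAt h w q).pow_left q.natDegree).eq
    refine ⟨u ^ q.natDegree * a + algebraMap ℂ R γ * z ^ k * b, β * b, ?_⟩
    calc u ^ (q.natDegree * (k + 1))
        = u ^ q.natDegree * (homogAt u z w q * a + z ^ k * b) := by
          rw [← hab, ← pow_add]; congr 1; ring
      _ = homogAt u z w q * (u ^ q.natDegree * a) + u ^ q.natDegree * z ^ k * b := by
          rw [mul_add, ← mul_assoc, hcomm]; noncomm_ring
      _ = _ := by
          have : u ^ q.natDegree * z ^ k * b =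
              homogAt u z w q * (algebraMap ℂ R γ * z ^ k * b) + z ^ (k + 1) * (β * b) := by
            rw [hβ, add_mul, add_mul, mul_assoc z β, ← ((hz β).pow_left k).eq, pow_succ']
            noncomm_ring
          rw [this, mul_add, add_assoc]

lemma mul_pow_succ_eq {x y z : R} {n : ℕ} (hz : ∀ v : R, Commute z v)
    (hxy : x * y - y * x = z ^ n) (b : ℕ) :
    x * y ^ (b + 1) = y ^ (b + 1) * x + (b + 1 : ℂ) • (y ^ b * z ^ n) := by
  have hxy' : x * y = y * x + z ^ n := by rw [← hxy]; abel
  induction b with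
  | zero => simp [hxy']
  | succ b ih =>
    rw [pow_succ y (b + 1), ← mul_assoc, ih, add_mul, mul_assoc _ x y, hxy', smul_mul_assoc,
      mul_assoc (y ^ b), ((hz y).pow_left n).eq, ← mul_assoc (y ^ b), ← pow_succ, mul_add,
      ← mul_assoc, add_assoc]
    congr 1
    push_cast
    module

lemma pow_mul_pow_add_eq {x y z : R} {n : ℕ} (hz : ∀ v : R, Commute z v)
    (hxy : x * y - y * x = z ^ n) (a b : ℕ) : ∃ u, x ^ a * y ^ (b + a) = y ^ b * u := by
  induction a generalizing b with
  | zero => exact ⟨1, by simp⟩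
  | succ a ih =>
    obtain ⟨u, hu⟩ := ih (b + 1)
    refine ⟨(y * x + (b + 1 : ℂ) • z ^ n) * u, ?_⟩
    rw [pow_succ', mul_assoc, show b + (a + 1) = b + 1 + a by ring, hu, ← mul_assoc,
      mul_pow_succ_eq hz hxy, pow_succ, ← mul_assoc, mul_add, mul_smul_comm, mul_assoc _ y x]

/-- The span of the monomials `x^a y^b z^c` with `b < B`. -/
def spanPowLT (x y z : R) (B : ℕ) : Submodule ℂ R :=
  Submodule.span ℂ {m | ∃ a b c : ℕ, b < B ∧ m = x ^ a * y ^ b * z ^ c}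

lemma pow_mul_mul_mem_spanPowLT {x y z : R} {n : ℕ} (hz : ∀ v : R, Commute z v)
    (hxy : x * y - y * x = z ^ n) {B b : ℕ} (hb : b < B) (a c : ℕ) :
    x ^ a * y ^ b * z ^ c * x - x ^ (a + 1) * y ^ b * z ^ c ∈ spanPowLT x y z b := by
  rw [mul_assoc, ((hz x).pow_left c).eq, ← mul_assoc, ← sub_mul, pow_succ, mul_assoc _ x,
    mul_assoc, ← mul_sub]
  cases b with
  | zero => simp
  | succ b =>
    rw [mul_pow_succ_eq hz hxy, sub_add_cancel_left, mul_neg, neg_mul, mul_smul_comm,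
      smul_mul_assoc, ← mul_assoc, mul_assoc, ← pow_add]
    exact neg_mem (Submodule.smul_mem _ _ (Submodule.subset_span ⟨a, b, _, by omega, rfl⟩))

lemma spanPowLT_mono (x y z : R) {B B' : ℕ} (h : B ≤ B') :
    spanPowLT x y z B ≤ spanPowLT x y z B' :=
  Submodule.span_mono fun _ ⟨a, b, c, hb, hm⟩ => ⟨a, b, c, hb.trans_le h, hm⟩

lemma mul_mem_spanPowLT {x y z : R} {n : ℕ} (hz : ∀ v : R, Commute z v)
    (hxy : x * y - y * x = z ^ n) {B : ℕ} {m : R} (hm : m ∈ spanPowLT x y z B) :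
    m * x ∈ spanPowLT x y z B := by
  refine (Submodule.span_le (p := (spanPowLT x y z B).comap (LinearMap.mulRight ℂ x))).2 ?_ hm
  rintro _ ⟨a, b, c, hb, rfl⟩
  have h := spanPowLT_mono x y z hb.le (pow_mul_mul_mem_spanPowLT hz hxy hb a c)
  have h' : x ^ (a + 1) * y ^ b * z ^ c ∈ spanPowLT x y z B :=
    Submodule.subset_span ⟨_, b, c, hb, rfl⟩
  simpa using add_mem h h'

lemma pow_mul_pow_sub_mem_spanPowLT {x y z : R} {n : ℕ} (hz : ∀ v : R, Commute z v)
    (hxy : x * y - y * x = z ^ n) (a b : ℕ) :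
    y ^ b * x ^ a - x ^ a * y ^ b ∈ spanPowLT x y z b := by
  induction a with
  | zero => simp
  | succ a ih =>
    have h := pow_mul_mul_mem_spanPowLT hz hxy (Nat.lt_succ_self b) a 0
    have := add_mem (mul_mem_spanPowLT hz hxy ih) h
    simpa [sub_mul, mul_assoc, pow_succ] using this

lemma pow_sub_one_mul_mem {J : Submodule ℂ R} (z : R)
    (hzJ : ∀ v, (z - 1) * v ∈ J) (c : ℕ) (v : R) : (z ^ c - 1) * v ∈ J := by
  rw [← mul_geom_sum, mul_assoc]
  exact hzJ _

lemma mul_pow_mem_iff {J F : Submodule ℂ R} {z : R} (hz : ∀ v : R, Commute z v)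
    (hzJ : ∀ v, (z - 1) * v ∈ J) (hJF : J ≤ F) (m : R) (c : ℕ) : m * z ^ c ∈ F ↔ m ∈ F := by
  have h := hJF (pow_sub_one_mul_mem z hzJ c m)
  rw [sub_mul, one_mul, ((hz m).pow_left c).eq] at h
  exact ⟨fun hm => by simpa using sub_mem hm h, fun hm => by simpa using add_mem h hm⟩

/-- Monomials reduce modulo a right ideal containing `z - 1` and the homogenizations of `p(x)`
and `q(y)`. -/
lemma pow_mul_pow_mem {J F : Submodule ℂ R} {x y z : R} {n w w' : ℕ} {p q : Polynomial ℂ}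
    (hz : ∀ v : R, Commute z v) (hxy : x * y - y * x = z ^ n) (hp : p ≠ 0) (hq : q ≠ 0)
    (hzJ : ∀ v, (z - 1) * v ∈ J) (hpJ : ∀ v, homogAt x z w p * v ∈ J)
    (hqJ : ∀ v, homogAt y z w' q * v ∈ J) (hJF : J ≤ F)
    (hF : ∀ i < p.natDegree, ∀ j < q.natDegree, x ^ i * y ^ j ∈ F) (a b : ℕ) :
    x ^ a * y ^ b ∈ F := by
  have hzF := mul_pow_mem_iff hz hzJ hJF
  have reduce : ∀ (u : R) (e : ℕ) (r : Polynomial ℂ), r ≠ 0 →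
      (∀ v, homogAt u z e r * v ∈ J) → ∀ (k : ℕ), r.natDegree ≤ k → ∀ v,
      (∀ i < k, u ^ i * v ∈ F) → u ^ k * v ∈ F := by
    intro u e r hr hrJ k hk v hlow
    obtain ⟨γ, c, hc⟩ := pow_natDegree_eq_homogAt_add u z e hr
    obtain ⟨l, rfl⟩ := Nat.exists_eq_add_of_le hk
    rw [pow_add, hc, add_mul, add_mul, smul_mul_assoc, smul_mul_assoc, mul_assoc]
    refine add_mem (Submodule.smul_mem _ _ (hJF (hrJ _))) ?_
    rw [Finset.sum_mul, Finset.sum_mul]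
    refine sum_mem fun i hi => ?_
    rw [smul_mul_assoc, smul_mul_assoc, mul_assoc, mul_assoc, ((hz _).pow_left _).eq, ← mul_assoc,
      ← mul_assoc, ← pow_add]
    refine Submodule.smul_mem _ _ ((hzF _ _).2 (hlow _ ?_))
    simp at hi; omega
  induction b using Nat.strong_induction_on generalizing a with
  | _ b ihb =>
    by_cases hb : b < q.natDegree
    · induction a using Nat.strong_induction_on with
      | _ a iha =>
        by_cases ha : a < p.natDegree
        · exact hF a ha b hb
        · exact reduce x w p hp hpJ a (not_lt.1 ha) _ iha
    · have hU : ∀ B ≤ b, spanPowLT x y z B ≤ F := by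
        intro B hB
        refine Submodule.span_le.2 ?_
        rintro _ ⟨a, b', c, hb', rfl⟩
        exact (hzF _ _).2 (ihb b' (by omega) a)
      have hswap := hU b le_rfl (pow_mul_pow_sub_mem_spanPowLT hz hxy a b)
      have hyx : y ^ b * x ^ a ∈ F := by
        refine reduce y w' q hq hqJ b (not_lt.1 hb) _ fun i hi => ?_
        have := add_mem (hU i hi.le (pow_mul_pow_sub_mem_spanPowLT hz hxy a i)) (ihb i hi a)
        simpa using this
      simpa using sub_mem hyx hswap

/-- The Weyl algebra has no nonzero finite-dimensional modules: a right ideal of finite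
codimension on which the commutator `x y - y x` acts as the identity is everything. -/
lemma eq_top_of_finiteDimensional_quotient {J : Submodule ℂ R} {x y : R}
    (hJ : ∀ m ∈ J, ∀ v, m * v ∈ J) (hcomm : ∀ m, m * (x * y - y * x) - m ∈ J)
    [FiniteDimensional ℂ (R ⧸ J)] : J = ⊤ := by
  let ρ : R → ((R ⧸ J) →ₗ[ℂ] (R ⧸ J)) := fun v =>
    J.mapQ J (LinearMap.mulRight ℂ v) fun m hm => hJ m hm v
  have h : ρ y * ρ x - ρ x * ρ y = 1 := by
    ext m
    change J.mkQ (m * x * y) - J.mkQ (m * y * x) = J.mkQ m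
    rw [← map_sub, ← sub_eq_zero, ← map_sub, Submodule.mkQ_apply, Submodule.Quotient.mk_eq_zero]
    simpa [mul_sub, mul_assoc] using hcomm m
  have ht := congrArg (LinearMap.trace ℂ (R ⧸ J)) h
  rw [map_sub, LinearMap.trace_mul_comm, sub_self, LinearMap.trace_one] at ht
  have h0 : Module.finrank ℂ (R ⧸ J) = 0 := by exact_mod_cast ht.symm
  have := Module.finrank_zero_iff.1 h0
  exact Submodule.Quotient.subsingleton_iff.1 this

end Algebra

section HWeyl

variable (w₁ w₂ : ℕ)

lemma HX_mul_HZ : HX w₁ w₂ * HZ w₁ w₂ = HZ w₁ w₂ * HX w₁ w₂ := by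
  simpa [HX, HZ] using RingQuot.mkAlgHom_rel ℂ (HRel.xz (w₁ := w₁) (w₂ := w₂))

lemma HY_mul_HZ : HY w₁ w₂ * HZ w₁ w₂ = HZ w₁ w₂ * HY w₁ w₂ := by
  simpa [HY, HZ] using RingQuot.mkAlgHom_rel ℂ (HRel.yz (w₁ := w₁) (w₂ := w₂))

lemma HX_mul_HY_sub :
    HX w₁ w₂ * HY w₁ w₂ - HY w₁ w₂ * HX w₁ w₂ = HZ w₁ w₂ ^ (w₁ + w₂) := by
  simpa [HX, HY, HZ] using RingQuot.mkAlgHom_rel ℂ (HRel.xy (w₁ := w₁) (w₂ := w₂))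

variable {w₁ w₂} in
/-- Induction on elements of `𝐀(w)`: a property holds everywhere if it holds for the generators
and the scalars and is compatible with products and sums. -/
lemma HWeyl.induction {P : HWeyl w₁ w₂ → Prop} (hX : P (HX w₁ w₂)) (hY : P (HY w₁ w₂))
    (hZ : P (HZ w₁ w₂)) (halg : ∀ c : ℂ, P (algebraMap ℂ _ c))
    (hmul : ∀ a b, P a → P b → P (a * b)) (hadd : ∀ a b, P a → P b → P (a + b))
    (v : HWeyl w₁ w₂) : P v := by
  obtain ⟨f, rfl⟩ := RingQuot.mkAlgHom_surjective ℂ (HRel w₁ w₂) v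
  induction f using FreeAlgebra.induction with
  | grade0 c => simpa using halg c
  | grade1 i => fin_cases i <;> assumption
  | mul a b ha hb => simpa using hmul _ _ ha hb
  | add a b ha hb => simpa using hadd _ _ ha hb

lemma commute_HZ (v : HWeyl w₁ w₂) : Commute (HZ w₁ w₂) v := by
  induction v using HWeyl.induction with
  | hX => exact (HX_mul_HZ w₁ w₂).symm
  | hY => exact (HY_mul_HZ w₁ w₂).symm
  | hZ => exact Commute.refl _
  | halg c => exact (Algebra.commutes c _).symm
  | hmul a b ha hb => exact ha.mul_right hb
  | hadd a b ha hb => exact ha.add_right hb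

/-- The monomials `X^a Y^b Z^c` span `𝐀(w)`. -/
lemma span_monomials_eq_top : Submodule.span ℂ {m : HWeyl w₁ w₂ | ∃ a b c : ℕ,
    m = HX w₁ w₂ ^ a * HY w₁ w₂ ^ b * HZ w₁ w₂ ^ c} = ⊤ := by
  set S := Submodule.span ℂ {m : HWeyl w₁ w₂ | ∃ a b c : ℕ,
    m = HX w₁ w₂ ^ a * HY w₁ w₂ ^ b * HZ w₁ w₂ ^ c}
  have hz := commute_HZ w₁ w₂
  have hgen : ∀ v, (∀ a b c : ℕ, HX w₁ w₂ ^ a * HY w₁ w₂ ^ b * HZ w₁ w₂ ^ c * v ∈ S) →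
      ∀ m ∈ S, m * v ∈ S := by
    intro v hv m hm
    refine (Submodule.span_le (p := S.comap (LinearMap.mulRight ℂ v))).2 ?_ hm
    rintro _ ⟨a, b, c, rfl⟩
    exact hv a b c
  have hmul : ∀ v : HWeyl w₁ w₂, ∀ m ∈ S, m * v ∈ S := by
    intro v
    induction v using HWeyl.induction with
    | hX =>
      refine hgen _ fun a b c => ?_
      have hle : spanPowLT (HX w₁ w₂) (HY w₁ w₂) (HZ w₁ w₂) b ≤ S :=
        Submodule.span_mono fun _ ⟨a, b, c, _, hm⟩ => ⟨a, b, c, hm⟩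
      have h := hle (pow_mul_mul_mem_spanPowLT hz (HX_mul_HY_sub w₁ w₂) (Nat.lt_succ_self b) a c)
      have h' : HX w₁ w₂ ^ (a + 1) * HY w₁ w₂ ^ b * HZ w₁ w₂ ^ c ∈ S :=
        Submodule.subset_span ⟨_, b, c, rfl⟩
      simpa using add_mem h h'
    | hY =>
      refine hgen _ fun a b c => Submodule.subset_span ⟨a, b + 1, c, ?_⟩
      rw [mul_assoc, ((hz _).pow_left c).eq, pow_succ]
      noncomm_ring
    | hZ =>
      refine hgen _ fun a b c => Submodule.subset_span ⟨a, b, c + 1, ?_⟩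
      rw [pow_succ, mul_assoc _ _ (HZ w₁ w₂)]
    | halg r =>
      intro m hm
      rw [← Algebra.commutes, ← Algebra.smul_def]
      exact S.smul_mem r hm
    | hmul a b ha hb =>
      intro m hm
      rw [← mul_assoc]
      exact hb _ (ha _ hm)
    | hadd a b ha hb =>
      intro m hm
      rw [mul_add]
      exact add_mem (ha _ hm) (hb _ hm)
  refine eq_top_iff.2 fun v _ => ?_
  simpa using hmul v 1 (Submodule.subset_span ⟨0, 0, 0, by simp⟩)

/-- The grading of `𝐀(w)` as a coaction: a homogeneous element `v` of degree `k` is sent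
to `v T^k`. -/
def gradingHom : HWeyl w₁ w₂ →ₐ[ℂ] Polynomial (HWeyl w₁ w₂) :=
  RingQuot.liftAlgHom ℂ ⟨FreeAlgebra.lift ℂ
    ![Polynomial.C (HX w₁ w₂) * Polynomial.X ^ w₁, Polynomial.C (HY w₁ w₂) * Polynomial.X ^ w₂,
      Polynomial.C (HZ w₁ w₂) * Polynomial.X], by
    have hmono : ∀ (a b : HWeyl w₁ w₂) (i j : ℕ),
        Polynomial.C a * Polynomial.X ^ i * (Polynomial.C b * Polynomial.X ^ j) =
          Polynomial.C (a * b) * Polynomial.X ^ (i + j) := by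
      intro a b i j
      simp [Polynomial.C_mul_X_pow_eq_monomial, Polynomial.monomial_mul_monomial,
        -map_mul]
    intro a b h
    cases h with
    | xz =>
      have := hmono (HX w₁ w₂) (HZ w₁ w₂) w₁ 1
      have h' := hmono (HZ w₁ w₂) (HX w₁ w₂) 1 w₁
      rw [pow_one] at this h'
      simp [this, h', HX_mul_HZ, add_comm]
    | yz =>
      have := hmono (HY w₁ w₂) (HZ w₁ w₂) w₂ 1
      have h' := hmono (HZ w₁ w₂) (HY w₁ w₂) 1 w₂
      rw [pow_one] at this h'
      simp [this, h', HY_mul_HZ, add_comm]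
    | xy =>
      simp only [map_sub, map_mul, map_pow, FreeAlgebra.lift_ι_apply, Matrix.cons_val_zero,
        Matrix.cons_val_one, Matrix.cons_val]
      rw [hmono, hmono, add_comm w₂ w₁, (Polynomial.commute_X _).symm.mul_pow, ← Polynomial.C_pow,
        ← HX_mul_HY_sub, Polynomial.C_sub]
      exact (sub_mul (Polynomial.C (HX w₁ w₂ * HY w₁ w₂)) _ _).symm⟩

@[simp] lemma gradingHom_HX :
    gradingHom w₁ w₂ (HX w₁ w₂) = Polynomial.monomial w₁ (HX w₁ w₂) := by
  simp [gradingHom, HX, Polynomial.C_mul_X_pow_eq_monomial]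

@[simp] lemma gradingHom_HY :
    gradingHom w₁ w₂ (HY w₁ w₂) = Polynomial.monomial w₂ (HY w₁ w₂) := by
  simp [gradingHom, HY, Polynomial.C_mul_X_pow_eq_monomial]

@[simp] lemma gradingHom_HZ :
    gradingHom w₁ w₂ (HZ w₁ w₂) = Polynomial.monomial 1 (HZ w₁ w₂) := by
  simp [gradingHom, HZ, Polynomial.C_mul_X_eq_monomial]

lemma gradingHom_homogAt {u : HWeyl w₁ w₂} {w : ℕ}
    (hu : gradingHom w₁ w₂ u = Polynomial.monomial w u) (q : Polynomial ℂ) :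
    gradingHom w₁ w₂ (homogAt u (HZ w₁ w₂) w q) =
      Polynomial.monomial (w * q.natDegree) (homogAt u (HZ w₁ w₂) w q) := by
  simp only [homogAt, map_sum, map_smul, map_mul, map_pow, hu, gradingHom_HZ,
    Polynomial.monomial_pow, Polynomial.monomial_mul_monomial]
  refine Finset.sum_congr rfl fun i hi => ?_
  rw [Polynomial.smul_monomial]
  congr 2
  rw [one_mul, ← mul_add, Nat.add_sub_cancel' (by simp at hi; omega)]

lemma coeff_gradingHom_homogAt_mul {u : HWeyl w₁ w₂} {w : ℕ}
    (hu : gradingHom w₁ w₂ u = Polynomial.monomial w u) (q : Polynomial ℂ) (v : HWeyl w₁ w₂)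
    (k : ℕ) : ∃ v', (gradingHom w₁ w₂ (homogAt u (HZ w₁ w₂) w q * v)).coeff k =
      homogAt u (HZ w₁ w₂) w q * v' := by
  rw [map_mul, gradingHom_homogAt w₁ w₂ hu, ← Polynomial.C_mul_X_pow_eq_monomial, mul_assoc,
    Polynomial.coeff_C_mul]
  exact ⟨_, rfl⟩

variable {w₁ w₂} in
lemma exists_HZ_pow_mem {q₁ q₂ : Polynomial ℂ} (hq₁ : q₁ ≠ 0) (hq₂ : q₂ ≠ 0) :
    ∃ r, HZ w₁ w₂ ^ r ∈ rightIdealPair (homogAt (HX w₁ w₂) (HZ w₁ w₂) w₁ q₁)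
      (homogAt (HY w₁ w₂) (HZ w₁ w₂) w₂ q₂) := by
  set Q₁ := homogAt (HX w₁ w₂) (HZ w₁ w₂) w₁ q₁
  set Q₂ := homogAt (HY w₁ w₂) (HZ w₁ w₂) w₂ q₂
  set J := rightIdealPair Q₁ Q₂
  have hz := commute_HZ w₁ w₂
  let J' := J ⊔ LinearMap.range (LinearMap.mulLeft ℂ (HZ w₁ w₂ - 1))
  have hzJ' : ∀ v, (HZ w₁ w₂ - 1) * v ∈ J' := fun v => Submodule.mem_sup_right ⟨v, rfl⟩
  have hJ' : ∀ m ∈ J', ∀ v, m * v ∈ J' := by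
    intro m hm v
    obtain ⟨j, hj, _, ⟨c, rfl⟩, rfl⟩ := Submodule.mem_sup.1 hm
    rw [add_mul, LinearMap.mulLeft_apply, mul_assoc]
    exact add_mem (Submodule.mem_sup_left (mul_mem_rightIdealPair hj v)) (hzJ' _)
  let W : Submodule ℂ (HWeyl w₁ w₂) := Submodule.span ℂ
    (Set.image (fun ij : ℕ × ℕ => HX w₁ w₂ ^ ij.1 * HY w₁ w₂ ^ ij.2)
      (Finset.range q₁.natDegree ×ˢ Finset.range q₂.natDegree : Finset (ℕ × ℕ)))
  have hW : J' ⊔ W = ⊤ := by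
    rw [eq_top_iff, ← span_monomials_eq_top, Submodule.span_le]
    rintro _ ⟨a, b, c, rfl⟩
    refine (mul_pow_mem_iff hz hzJ' le_sup_left _ _).2
      (pow_mul_pow_mem hz (HX_mul_HY_sub w₁ w₂) hq₁ hq₂ hzJ'
        (fun v => Submodule.mem_sup_left (left_mul_mem_rightIdealPair Q₁ Q₂ v))
        (fun v => Submodule.mem_sup_left (right_mul_mem_rightIdealPair Q₁ Q₂ v)) le_sup_left
        (fun i hi j hj => Submodule.mem_sup_right (Submodule.subset_span
          (Set.mem_image_of_mem _ (x := (i, j)) (by simp [hi, hj])))) a b)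
  have hfin : FiniteDimensional ℂ (HWeyl w₁ w₂ ⧸ J') := by
    have hmap : W.map J'.mkQ = ⊤ := by
      have := congrArg (Submodule.map J'.mkQ) hW
      simpa [Submodule.map_sup, Submodule.mkQ_map_self] using this
    refine ⟨hmap ▸ Submodule.FG.map _ (Submodule.fg_span ?_)⟩
    exact (Finset.finite_toSet _).image _
  have htop : J' = ⊤ := by
    refine eq_top_of_finiteDimensional_quotient (x := HX w₁ w₂) (y := HY w₁ w₂) hJ' fun m => ?_
    rw [HX_mul_HY_sub, ← ((hz m).pow_left _).eq]
    simpa [sub_mul] using pow_sub_one_mul_mem (HZ w₁ w₂) hzJ' (w₁ + w₂) m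
  obtain ⟨j, hj, _, ⟨c, rfl⟩, hjc⟩ := Submodule.mem_sup.1 (htop ▸ Submodule.mem_top : 1 ∈ J')
  obtain ⟨a, b, rfl⟩ := mem_rightIdealPair.1 hj
  have hcoeff : ∀ k, (gradingHom w₁ w₂ (Q₁ * a + Q₂ * b)).coeff k ∈ J := by
    intro k
    obtain ⟨a', ha'⟩ := coeff_gradingHom_homogAt_mul w₁ w₂ (gradingHom_HX w₁ w₂) q₁ a k
    obtain ⟨b', hb'⟩ := coeff_gradingHom_homogAt_mul w₁ w₂ (gradingHom_HY w₁ w₂) q₂ b k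
    rw [map_add, Polynomial.coeff_add, ha', hb']
    exact mem_rightIdealPair.2 ⟨a', b', rfl⟩
  set C := gradingHom w₁ w₂ c
  have hrel : gradingHom w₁ w₂ (Q₁ * a + Q₂ * b) =
      1 + C - Polynomial.C (HZ w₁ w₂) * (Polynomial.X * C) := by
    have h1 : Q₁ * a + Q₂ * b = 1 + c - HZ w₁ w₂ * c := by
      rw [← hjc, LinearMap.mulLeft_apply, sub_mul, one_mul, add_assoc, sub_add_cancel,
        add_sub_cancel_right]
    rw [h1, map_sub, map_add, map_one, map_mul, gradingHom_HZ,
      ← Polynomial.C_mul_X_eq_monomial, mul_assoc]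
  have hpow : ∀ k, HZ w₁ w₂ ^ k + C.coeff k ∈ J := by
    intro k
    induction k with
    | zero => simpa [hrel] using hcoeff 0
    | succ k ih =>
      have h := hcoeff (k + 1)
      rw [hrel] at h
      simp only [Polynomial.coeff_sub, Polynomial.coeff_add, Polynomial.coeff_C_mul,
        Polynomial.coeff_X_mul, Polynomial.coeff_one] at h
      have h' := add_mem h (mul_mem_rightIdealPair ih (HZ w₁ w₂))
      rw [← (hz _).eq, mul_add, ← pow_succ'] at h'
      simpa [add_comm, add_left_comm] using h'
  refine ⟨C.natDegree + 1, ?_⟩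
  simpa [Polynomial.coeff_eq_zero_of_natDegree_lt] using hpow (C.natDegree + 1)

end HWeyl

/-- For nonzero `q₁(x)` and `q₂(y)` with homogenizations `𝐪₁, 𝐪₂ ∈ 𝐀(w)`, there is `m ≥ 0`
with `𝐀(w)_{≥ m} ⊆ 𝐪₁𝐀(w) + 𝐪₂𝐀(w)`: every homogeneous element of degree `≥ m` lies in the
right ideal generated by `𝐪₁` and `𝐪₂`. -/
theorem hweyl_covering (w₁ w₂ : ℕ) (h₁ : 0 < w₁) (h₂ : 0 < w₂)
    (q₁ q₂ : Polynomial ℂ) (hq₁ : q₁ ≠ 0) (hq₂ : q₂ ≠ 0) :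
    ∃ m : ℕ, ∀ k : ℕ, m ≤ k → ∀ x ∈ HComp w₁ w₂ k,
      ∃ a b : HWeyl w₁ w₂, x = homogX w₁ w₂ q₁ * a + homogY w₁ w₂ q₂ * b := by
  obtain ⟨r, hr⟩ := exists_HZ_pow_mem (w₁ := w₁) (w₂ := w₂) hq₁ hq₂
  have hz := commute_HZ w₁ w₂
  obtain ⟨a₁, b₁, hX⟩ := pow_natDegree_mul_eq (hz (HX w₁ w₂)).symm h₁ hz hq₁ r
  obtain ⟨a₂, b₂, hY⟩ := pow_natDegree_mul_eq (hz (HY w₁ w₂)).symm h₂ hz hq₂ r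
  set d₁ := q₁.natDegree * r
  set d₂ := q₂.natDegree * r
  refine ⟨w₁ * d₁ + w₂ * (d₂ + d₁) + r, fun k hk x hx => ?_⟩
  change ∃ a b, x = homogAt (HX w₁ w₂) (HZ w₁ w₂) w₁ q₁ * a +
    homogAt (HY w₁ w₂) (HZ w₁ w₂) w₂ q₂ * b
  rw [← mem_rightIdealPair]
  refine (Submodule.span_le.2 ?_) hx
  rintro _ ⟨a, b, c, hdeg, rfl⟩
  have hXJ := add_mem (left_mul_mem_rightIdealPair _ (homogAt (HY w₁ w₂) (HZ w₁ w₂) w₂ q₂) a₁)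
    (mul_mem_rightIdealPair hr b₁)
  have hYJ := add_mem (right_mul_mem_rightIdealPair (homogAt (HX w₁ w₂) (HZ w₁ w₂) w₁ q₁) _ a₂)
    (mul_mem_rightIdealPair hr b₂)
  rw [← hX] at hXJ
  rw [← hY] at hYJ
  rcases le_or_gt r c with hc | hc
  · obtain ⟨l, rfl⟩ := Nat.exists_eq_add_of_le hc
    rw [← ((hz _).pow_left _).eq, pow_add, mul_assoc]
    exact mul_mem_rightIdealPair hr _
  rcases le_or_gt d₁ a with ha | ha
  · obtain ⟨l, rfl⟩ := Nat.exists_eq_add_of_le ha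
    rw [pow_add, mul_assoc, mul_assoc]
    exact mul_mem_rightIdealPair hXJ _
  have hb : d₂ + a ≤ b := by
    by_contra! hb
    have := Nat.mul_le_mul_left w₁ ha.le
    have := Nat.mul_le_mul_left w₂ (show b ≤ d₂ + d₁ by omega)
    omega
  obtain ⟨l, rfl⟩ := Nat.exists_eq_add_of_le hb
  obtain ⟨u, hu⟩ := pow_mul_pow_add_eq hz (HX_mul_HY_sub w₁ w₂) a d₂
  rw [pow_add, ← mul_assoc, hu, mul_assoc, mul_assoc]
  exact mul_mem_rightIdealPair hYJ _
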